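/- Suppose T is a shifted tableau such that row(T) or col(T) is a primed involution word for an element of I_ℤ. Then T is increasing if and only if unprime(T), the tableau obtained by removing all primes from the entries of T, is increasing. -/

import Mathlib

/-! ## Primed letters: the alphabet `ℤ ⊔ ℤ'`, with `i' = i - 1/2`.
A letter is encoded by its "ceiling" together with a flag recording whether it is primed. -/

structure Letter where
  ceil : ℤ
  primed : Bool
deriving DecidableEq, Repr

instance : Inhabited Letter := ⟨⟨0, false⟩⟩

/-- The order `⋯ < 1' < 1 < 2' < 2 < ⋯`. -/
instance : LinearOrder Letter :=
  LinearOrder.lift' (fun x : Letter => toLex (x.ceil, !x.primed))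
    (fun a b h => by
      have h' : (a.ceil, !a.primed) = (b.ceil, !b.primed) := toLex.injective h
      obtain ⟨ac, ap⟩ := a
      obtain ⟨bc, bp⟩ := b
      simp only [Prod.mk.injEq] at h'
      obtain ⟨h1, h2⟩ := h'
      cases ap <;> cases bp <;> simp_all)

/-- A primed word. -/
abbrev PWord := List Letter

def Letter.unprime (x : Letter) : Letter := ⟨x.ceil, false⟩

def Letter.succL (x : Letter) : Letter := ⟨x.ceil + 1, x.primed⟩

/-- `unprime` of a primed word: replace each letter `x` by `⌈x⌉`. -/
def unprimeWord (a : PWord) : List ℤ := a.map Letter.ceil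

/-- `unprime` of a primed word, as a primed word with no primes. -/
def unprimeP (a : PWord) : PWord := a.map Letter.unprime

/-! ## Involution words -/

/-- The simple transposition `s_i = (i, i+1)` of `ℤ`. -/
def sPerm (i : ℤ) : Equiv.Perm ℤ := Equiv.swap i (i + 1)

/-- The Demazure product `s_{w_1} ∘ s_{w_2} ∘ ⋯ ∘ s_{w_k}` of a word, computed by the
defining recursion `σ ∘ s_i = σ·s_i` if `σ(i) < σ(i+1)` and `σ ∘ s_i = σ` otherwise. -/
def heckeProd (w : List ℤ) : Equiv.Perm ℤ :=
  w.foldl (fun σ i => if σ i < σ (i + 1) then σ * sPerm i else σ) 1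

/-- `s_{a_n} ∘ ⋯ ∘ s_{a_2} ∘ s_{a_1} ∘ s_{a_2} ∘ ⋯ ∘ s_{a_n}` for `a = a_1 a_2 ⋯ a_n`. -/
def invHecke (a : List ℤ) : Equiv.Perm ℤ := heckeProd (a.reverse ++ a.tail)

/-- Membership in `I_ℤ`: a finitely supported involution of `ℤ`. -/
def IZ (z : Equiv.Perm ℤ) : Prop := {x : ℤ | z x ≠ x}.Finite ∧ z * z = 1

/-- The set of involution words of `z`. -/
def Rinv (z : Equiv.Perm ℤ) : Set (List ℤ) :=
  {a | invHecke a = z ∧ ∀ b : List ℤ, invHecke b = z → a.length ≤ b.length}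

/-- 0-based index `k` is a commutation in the word `a` (this corresponds to the 1-based
index `k+1`): `a_{k+1}` and `a_{k+1} + 1` are both fixed points of
`s_{a_k} ∘ ⋯ ∘ s_{a_1} ∘ ⋯ ∘ s_{a_k}`. -/
def IsCommutation (a : List ℤ) (k : ℕ) : Prop :=
  ∃ x, a[k]? = some x ∧ invHecke (a.take k) x = x ∧ invHecke (a.take k) (x + 1) = x + 1

/-- The set of primed involution words of `z`. -/
def RinvPlus (z : Equiv.Perm ℤ) : Set PWord :=
  {a | unprimeWord a ∈ Rinv z ∧
     ∀ (k : ℕ) (x : Letter), a[k]? = some x → x.primed = true →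
       IsCommutation (unprimeWord a) k}

/-! ## Shifted tableaux.
A shifted tableau is recorded as its list of rows, from the first (bottom) row upward;
the entry at 0-based index `k` of 0-based row `r` occupies the box in row `r+1` and
column `r+1+k` of the shifted diagram. -/

abbrev STab := List (List Letter)

/-- A strict partition, recorded as its (strictly decreasing) list of positive parts. -/
def IsStrictPartition (sh : List ℕ) : Prop :=
  List.Chain' (fun a b => b < a) sh ∧ ∀ m ∈ sh, 0 < m

def shapeOf {α : Type*} (T : List (List α)) : List ℕ := T.map List.length

/-- The rows form the shifted diagram of a strict partition. -/
def IsShifted {α : Type*} (T : List (List α)) : Prop := IsStrictPartition (shapeOf T)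

/-- The entry of `T` in (0-based) row `r` and column `c` of the shifted diagram. -/
def entryG? {α : Type*} (T : List (List α)) (r c : ℕ) : Option α :=
  if r ≤ c then (T[r]?).bind (fun row => row[c - r]?) else none

def entry? (T : STab) (r c : ℕ) : Option Letter := entryG? T r c

def setRowG {α : Type*} (T : List (List α)) (r : ℕ) (row : List α) : List (List α) :=
  if r < T.length then T.set r row else T ++ [row]

def setEntryG {α : Type*} (T : List (List α)) (r c : ℕ) (x : α) : List (List α) :=
  T.set r ((T.getD r []).set (c - r) x)

def numCols {α : Type*} (T : List (List α)) : ℕ := (T.getD 0 []).length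

/-- Row reading word: rows left to right, starting with the last (top) row. -/
def rowWord (T : STab) : PWord := T.reverse.flatten

/-- Column reading word: columns top to bottom, starting with the first column. -/
def colWord (T : STab) : PWord :=
  (List.range (numCols T)).flatMap (fun c =>
    ((List.range (c + 1)).reverse).filterMap (fun r => entry? T r c))

def unprimeT (T : STab) : STab := T.map (List.map Letter.unprime)

/-- Remove the primes from all main-diagonal entries. -/
def unprimeDiagT (T : STab) : STab :=
  T.map (fun row =>
    match row with
    | [] => []
    | x :: rest => Letter.unprime x :: rest)

/-- Rows and columns are strictly increasing. -/
def IsIncreasing (T : STab) : Prop :=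
  (∀ r c x y, entry? T r c = some x → entry? T r (c + 1) = some y → x < y) ∧
  (∀ r c x y, entry? T r c = some x → entry? T (r + 1) c = some y → x < y)

/-- No primed entries on the main diagonal. -/
def NoDiagPrimes (T : STab) : Prop :=
  ∀ r x, entry? T r r = some x → x.primed = false

/-- Entries positive, rows and columns weakly increasing, no primed entry repeated
in a row and no unprimed entry repeated in a column. -/
def IsSemistandard (T : STab) : Prop :=
  (∀ x ∈ T.flatten, 0 < x.ceil) ∧
  (∀ r c x y, entry? T r c = some x → entry? T r (c + 1) = some y → x ≤ y) ∧
  (∀ r c x y, entry? T r c = some x → entry? T (r + 1) c = some y → x ≤ y) ∧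
  (∀ r c c' x, c < c' → entry? T r c = some x → entry? T r c' = some x →
    x.primed = false) ∧
  (∀ r r' c x, r < r' → entry? T r c = some x → entry? T r' c = some x →
    x.primed = true)

/-- Increasing, with exactly one of `i` or `i'` as an entry for each `i = 1, …, n`,
where `n` is the number of boxes. -/
def IsStandard (T : STab) : Prop :=
  IsIncreasing T ∧
  ∀ i : ℤ, 1 ≤ i → i ≤ (T.flatten.length : ℤ) →
    T.flatten.countP (fun x => decide (x.ceil = i)) = 1
/-! ## Orthogonal Edelman–Greene insertion -/

/-- "Switching the primes" of a pair: reverse the primes on both letters if exactly one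
of them is unprimed, and leave them unchanged otherwise. -/
def switchPrimes (x y : Letter) : Letter × Letter :=
  if x.primed = y.primed then (x, y)
  else (⟨x.ceil, !x.primed⟩, ⟨y.ceil, !y.primed⟩)

/-- Column-insertion stage of orthogonal Edelman–Greene insertion:
insert letter `w` into column `c` of `T` (then continue into later columns). -/
def egCol : ℕ → STab → ℕ → Letter → STab × Bool
  | 0, T, _, _ => (T, true)
  | fuel + 1, T, c, w =>
    let occ := (List.range (c + 1)).filterMap (fun r => (entry? T r c).map (fun x => (r, x)))
    match occ.findIdx? (fun p => decide (w.ceil < p.2.ceil)) with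
    | none =>
        -- place `w` in the first empty box of the column
        let r := occ.length
        let w' := if r = c ∧ w.primed then Letter.unprime w else w
        (setRowG T r ((T.getD r []) ++ [w']), if r = c then w.primed else true)
    | some kM =>
        let km := (occ.findIdx? (fun p => decide (w.ceil ≤ p.2.ceil))).getD kM
        let im := (occ.getD km (0, default)).1
        let m := (occ.getD km (0, default)).2
        if km = kM then
          if im = c then
            -- m = M on the main diagonal
            egCol fuel (setEntryG T im c (Letter.unprime w)) (c + 1) ⟨m.ceil, w.primed⟩
          else
            -- m = M off the main diagonal
            egCol fuel (setEntryG T im c w) (c + 1) m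
        else
          -- m < M : switch the primes on m and M, insert w+1 into the next column
          let iM := (occ.getD kM (0, default)).1
          let M := (occ.getD kM (0, default)).2
          let p := switchPrimes m M
          egCol fuel (setEntryG (setEntryG T im c p.1) iM c p.2) (c + 1) (Letter.succL w)

/-- Row-insertion stage of orthogonal Edelman–Greene insertion:
insert letter `w` into row `r` of `T`. -/
def egRow : ℕ → STab → ℕ → Letter → STab × Bool
  | 0, T, _, _ => (T, true)
  | fuel + 1, T, r, w =>
    let row := T.getD r []
    match row.findIdx? (fun x => decide (w.ceil < x.ceil)) with
    | none =>
        if row.isEmpty ∧ w.primed then (setRowG T r [Letter.unprime w], true)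
        else (setRowG T r (row ++ [w]), false)
    | some kM =>
        let km := (row.findIdx? (fun x => decide (w.ceil ≤ x.ceil))).getD kM
        let m := row.getD km default
        if km = kM then
          if km = 0 then
            -- m = M on the main diagonal
            egCol fuel (setRowG T r (row.set 0 (Letter.unprime w))) (r + 1)
              ⟨m.ceil, w.primed⟩
          else
            -- m = M off the main diagonal
            egRow fuel (setRowG T r (row.set km w)) (r + 1) m
        else
          -- m < M : switch primes; insert w+1 into the next column (if m is on the
          -- main diagonal) or the next row (otherwise)
          let M := row.getD kM default
          let p := switchPrimes m M
          let row' := (row.set km p.1).set kM p.2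
          if km = 0 then egCol fuel (setRowG T r row') (r + 1) (Letter.succL w)
          else egRow fuel (setRowG T r row') (r + 1) (Letter.succL w)

/-- `T ←ᴼ u` together with the flag recording whether the insertion ended in
column insertion. -/
def egInsert (T : STab) (u : Letter) : STab × Bool :=
  egRow (T.flatten.length + T.length + 2) T 0 u

/-- The orthogonal Edelman–Greene insertion tableau `P_EGᴼ(a)`. -/
def PEG (a : PWord) : STab := a.foldl (fun T u => (egInsert T u).1) []

/-- Add the recording letter `x` to `Q` in the unique box of `Pnew` not in `Pold`. -/
def addBox (Q Pold Pnew : STab) (x : Letter) : STab :=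
  match (List.range Pnew.length).find?
      (fun r => decide ((Pold.getD r []).length ≠ (Pnew.getD r []).length)) with
  | some r => setRowG Q r ((Q.getD r []) ++ [x])
  | none => Q

def QEGaux : STab → STab → ℕ → PWord → STab
  | _, Q, _, [] => Q
  | P, Q, n, u :: rest =>
      let res := egInsert P u
      QEGaux res.1 (addBox Q P res.1 ⟨(n : ℤ), res.2⟩) (n + 1) rest

/-- The orthogonal Edelman–Greene recording tableau `Q_EGᴼ(a)`. -/
def QEG (a : PWord) : STab := QEGaux [] [] 1 a

/-! ## Orthogonal Coxeter–Knuth operators -/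

def ock1 (x : Letter) : Letter := ⟨x.ceil, !x.primed⟩

def ock2 (x y : Letter) : Letter × Letter := (⟨y.ceil, x.primed⟩, ⟨x.ceil, y.primed⟩)

def ock3 (x y z : Letter) : Letter × Letter × Letter :=
  if x.ceil = z.ceil ∧ (x.ceil - y.ceil = 1 ∨ y.ceil - x.ceil = 1) then
    if x.primed = false ∧ y.primed = false ∧ z.primed = false then
      -- XYX ↔ YXY
      (⟨y.ceil, false⟩, ⟨x.ceil, false⟩, ⟨y.ceil, false⟩)
    else if x.primed = true ∧ y.primed = false ∧ z.primed = false then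
      -- X'YX ↦ YXY'
      (⟨y.ceil, false⟩, ⟨x.ceil, false⟩, ⟨y.ceil, true⟩)
    else if x.primed = false ∧ y.primed = false ∧ z.primed = true then
      -- YXY' ↦ X'YX
      (⟨y.ceil, true⟩, ⟨x.ceil, false⟩, ⟨y.ceil, false⟩)
    else (x, y, z)
  else if (x.ceil < z.ceil ∧ z.ceil < y.ceil) ∨ (y.ceil < z.ceil ∧ z.ceil < x.ceil) then
    -- ACB ↔ CAB
    (y, x, z)
  else if (y.ceil < x.ceil ∧ x.ceil < z.ceil) ∨ (z.ceil < x.ceil ∧ x.ceil < y.ceil) then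
    -- BCA ↔ BAC
    (x, z, y)
  else (x, y, z)

/-- The operator `ock_i` for `i ∈ ℤ`. -/
def ockW (i : ℤ) (a : PWord) : PWord :=
  if i = -1 then
    match a with
    | [] => []
    | x :: rest => ock1 x :: rest
  else if i = 0 then
    match a with
    | x :: y :: rest => (ock2 x y).1 :: (ock2 x y).2 :: rest
    | _ => a
  else if 1 ≤ i ∧ i + 2 ≤ (a.length : ℤ) then
    let k := (i - 1).toNat
    match a[k]?, a[k + 1]?, a[k + 2]? with
    | some x, some y, some z =>
        a.take k ++ [(ock3 x y z).1, (ock3 x y z).2.1, (ock3 x y z).2.2] ++ a.drop (k + 3)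
    | _, _, _ => a
  else a

/-- Orthogonal Coxeter–Knuth equivalence: generated by `a ∼ ock_i(a)` for all `i ∈ ℤ`. -/
def OckEquiv : PWord → PWord → Prop :=
  Relation.EqvGen (fun a b => ∃ i : ℤ, b = ockW i a)
/-! ## Descents -/

/-- Descent set of a primed word (as a set of 1-based positions). -/
def DesWord (a : PWord) : Set ℤ :=
  {i | ∃ k : ℕ, i = (k : ℤ) + 1 ∧ ∃ x y, a[k]? = some x ∧ a[k + 1]? = some y ∧ y < x}

/-- Descent set of a standard shifted tableau. -/
def DesT (T : STab) : Set ℤ :=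
  {i | 0 < i ∧ (
    (∃ r c r' c', entry? T r c = some ⟨i, false⟩ ∧
        entry? T r' c' = some ⟨i + 1, false⟩ ∧ r < r') ∨
    (∃ r c r' c', entry? T r c = some ⟨i, true⟩ ∧
        entry? T r' c' = some ⟨i + 1, true⟩ ∧ c < c') ∨
    (∃ r c r' c', entry? T r c = some ⟨i, false⟩ ∧
        entry? T r' c' = some ⟨i + 1, true⟩))}

/-! ## Dual equivalence operators on standard shifted tableaux -/

def numPrimes (T : STab) : ℕ := T.flatten.countP (fun x => x.primed)

/-- The entries of column `c`, read from bottom to top (increasing). -/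
def colLetters (T : STab) (c : ℕ) : PWord :=
  (List.range (c + 1)).filterMap (fun r => entry? T r c)

/-- The shifted reading word `unprime(C_q R_q ⋯ C_1 R_1)`. -/
def shword (T : STab) : List ℤ :=
  (((List.range (numCols T)).reverse).flatMap (fun idx =>
    (colLetters T idx).filter (fun x => x.primed) ++
      ((T.getD idx []).filter (fun x => !x.primed)))).map Letter.ceil

def idxOfZ (v : ℤ) : List ℤ → ℕ
  | [] => 0
  | x :: r => if x = v then 0 else idxOfZ v r + 1

def positionsOf (T : STab) : List (ℕ × ℕ) :=
  (List.range T.length).flatMap (fun r =>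
    (List.range (T.getD r []).length).map (fun k => (r, r + k)))

/-- The box `□_v` of `T` containing `v` or `v'`. -/
def boxOf (T : STab) (v : ℤ) : Option (ℕ × ℕ) :=
  (positionsOf T).find? (fun p =>
    match entry? T p.1 p.2 with
    | some x => decide (x.ceil = v)
    | none => false)

/-- Reverse the prime of the entry in position `(r, c)`. -/
def togglePos (T : STab) (r c : ℕ) : STab :=
  match entry? T r c with
  | some x => setEntryG T r c ⟨x.ceil, !x.primed⟩
  | none => T

/-- Switch the primes of the entries in the two given positions. -/
def switchAt (T : STab) (p q : ℕ × ℕ) : STab :=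
  match entry? T p.1 p.2, entry? T q.1 q.2 with
  | some x, some y =>
      if x.primed = y.primed then T else togglePos (togglePos T p.1 p.2) q.1 q.2
  | _, _ => T

/-- The row index of `□_v` if it is a main-diagonal box. -/
def diagBox? (T : STab) (v : ℤ) : Option ℕ :=
  (boxOf T v).bind (fun p => if p.1 = p.2 then some p.1 else none)

def switchDiag (T T' : STab) (u v : ℤ) : STab :=
  match diagBox? T u, diagBox? T v with
  | some r, some s => switchAt T' (r, r) (s, s)
  | _, _ => T'

/-- The operator `𝔰_i`. -/
def sOp (i : ℤ) (T : STab) : STab :=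
  match boxOf T i, boxOf T (i + 1) with
  | some (r1, c1), some (r2, c2) =>
      if r1 ≠ r2 ∧ c1 ≠ c2 then
        -- swap i ↔ i+1 and i' ↔ (i+1)'
        setEntryG (setEntryG T r1 c1 ⟨i + 1, ((entry? T r1 c1).getD default).primed⟩)
          r2 c2 ⟨i, ((entry? T r2 c2).getD default).primed⟩
      else if r1 ≠ c1 ∧ r2 ≠ c2 then
        -- same row or column, neither box diagonal: reverse both primes
        togglePos (togglePos T r1 c1) r2 c2
      else
        -- same row or column, one box diagonal
        let T1 := if r1 = c1 then togglePos T r2 c2 else togglePos T r1 c1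
        let T2 :=
          if 1 ≤ i - 1 ∧ (diagBox? T (i - 1)).isSome ∧ (diagBox? T (i + 1)).isSome then
            switchDiag T T1 (i - 1) (i + 1)
          else T1
        if i + 2 ≤ (T.flatten.length : ℤ) ∧ (diagBox? T i).isSome ∧
            (diagBox? T (i + 2)).isSome then
          switchDiag T T2 i (i + 2)
        else T2
  | _, _ => T

def btwn (a m b : ℕ) : Prop := (a < m ∧ m < b) ∨ (b < m ∧ m < a)

instance (a m b : ℕ) : Decidable (btwn a m b) := by unfold btwn; infer_instance

/-- The dual equivalence operator `𝔡_i` for `i ∈ ℤ`. -/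
def dOp (i : ℤ) (T : STab) : STab :=
  if ¬(1 ≤ i + 2 ∧ i + 2 ≤ (T.flatten.length : ℤ)) then T
  else if i = -1 then togglePos T 0 0
  else if i = 0 then togglePos T 0 1
  else
    let w := shword T
    if btwn (idxOfZ i w) (idxOfZ (i + 2) w) (idxOfZ (i + 1) w) then sOp i T
    else if btwn (idxOfZ (i + 1) w) (idxOfZ i w) (idxOfZ (i + 2) w) then sOp (i + 1) T
    else T

/-! ## Marked cycles -/

/-- The 2-cycles of `z`, as ordered pairs `(i, j)` with `i < j = z(i)`. -/
def cycSet (z : Equiv.Perm ℤ) : Set (ℤ × ℤ) := {p | p.1 < p.2 ∧ z p.1 = p.2}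

/-- `s_{a_n} ⋯ s_{a_{k+2}} s_{a_{k+1}}` (ordinary product; 0-based index `k`). -/
def suffixPerm (a : List ℤ) (k : ℕ) : Equiv.Perm ℤ :=
  ((a.drop (k + 1)).reverse.map sPerm).prod

/-- `γ_{k+1}(a)` as an ordered pair (junk value `(0,0)` off the commutation set). -/
def gammaPair (a : List ℤ) (k : ℕ) : ℤ × ℤ :=
  match a[k]? with
  | some x => (min (suffixPerm a k x) (suffixPerm a k (x + 1)),
               max (suffixPerm a k x) (suffixPerm a k (x + 1)))
  | none => (0, 0)
/-! ## Increasing factorization sequences and Schur Q-functions -/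

/-- `Incr_∞(R_inv^+(z))`: sequences of weakly increasing primed words, all but
finitely many empty, whose concatenation is a primed involution word for `z`. -/
def IncrSeq (z : Equiv.Perm ℤ) : Set (ℕ → PWord) :=
  {φ | (∀ n, List.Chain' (· ≤ ·) (φ n)) ∧
    ∃ N, (∀ n, N ≤ n → φ n = []) ∧ ((List.range N).map φ).flatten ∈ RinvPlus z}

/-- Least bound past which a sequence of words is empty. -/
noncomputable def seqBound (φ : ℕ → PWord) : ℕ := sInf {N | ∀ n, N ≤ n → φ n = []}

/-- The concatenation `a^1 a^2 ⋯` of a sequence of words. -/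
noncomputable def concatSeq (φ : ℕ → PWord) : PWord :=
  ((List.range (seqBound φ)).map φ).flatten

/-- `ℓ(a^1) + ⋯ + ℓ(a^i)`. -/
def prefLen (φ : ℕ → PWord) (i : ℕ) : ℕ := (((List.range i).map φ).map List.length).sum

/-- The minimal `i ≥ 1` with `j ≤ ℓ(a^1) + ⋯ + ℓ(a^i)`. -/
noncomputable def relabel (φ : ℕ → PWord) (j : ℤ) : ℤ :=
  ((sInf {i : ℕ | 1 ≤ i ∧ j ≤ (prefLen φ i : ℤ)} : ℕ) : ℤ)

/-- The semistandard recording tableau `Q_EGᴼ(φ)`. -/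
noncomputable def QEGseq (φ : ℕ → PWord) : STab :=
  (QEG (concatSeq φ)).map (List.map (fun x => (⟨relabel φ x.ceil, x.primed⟩ : Letter)))

/-- The insertion tableau `P_EGᴼ(φ)`. -/
noncomputable def PEGseq (φ : ℕ → PWord) : STab := PEG (concatSeq φ)

/-- The Schur Q-function of a strict partition: the coefficient of the monomial with
exponent vector `d` is the number of semistandard shifted tableaux `T` of the given
shape with `x^T = x^d`. -/
noncomputable def SchurQ (sh : List ℕ) : MvPowerSeries ℤ ℤ :=
  fun d => (({T : STab | shapeOf T = sh ∧ IsSemistandard T ∧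
    ∀ i : ℤ, d i = T.flatten.countP (fun x => decide (x.ceil = i))} : Set STab).ncard : ℤ)

/-- `Q_z = Σ_{φ ∈ Incr_∞(R_inv^+(z))} x^φ`. -/
noncomputable def Qz (z : Equiv.Perm ℤ) : MvPowerSeries ℤ ℤ :=
  fun d => (({φ : ℕ → PWord | φ ∈ IncrSeq z ∧
    (∀ i : ℕ, d ((i : ℤ) + 1) = (φ i).length) ∧
    (∀ j : ℤ, j ≤ 0 → d j = 0)} : Set (ℕ → PWord)).ncard : ℤ)

/-! ## Dominant involutions -/

/-- The shifted diagram `SD_λ ⊆ ℤ × ℤ` of a strict partition. -/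
def SDset (sh : List ℕ) : Set (ℤ × ℤ) :=
  {p | ∃ i j : ℕ, 1 ≤ i ∧ i ≤ sh.length ∧ 1 ≤ j ∧ j ≤ sh.getD (i - 1) 0 ∧
    p.1 = (i : ℤ) ∧ p.2 = (i : ℤ) + (j : ℤ) - 1}

/-- The involution Rothe diagram `D̂(z) = {(i,j) : z(i) > j ≤ i < z(j)}`. -/
def invRothe (z : Equiv.Perm ℤ) : Set (ℤ × ℤ) :=
  {p | p.2 < z p.1 ∧ p.2 ≤ p.1 ∧ p.1 < z p.2}

/-- The tableau `T_λ` with entry `i + j - 1` in box `(i, j)` of `SD_λ`. -/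
def Tlam (sh : List ℕ) : STab :=
  (List.range sh.length).map (fun r =>
    (List.range (sh.getD r 0)).map (fun k =>
      (⟨2 * (r : ℤ) + (k : ℤ) + 1, false⟩ : Letter)))

/-- The permutation `i + m ↦ w(i) + m` (fixing everything outside `m + support`). -/
def shiftPerm (m : ℕ) (w : Equiv.Perm ℤ) : Equiv.Perm ℤ :=
  (Equiv.addLeft (m : ℤ)).permCongr w

/-- `z ∈ S_m`: `z` fixes every point outside `[1, m]`. -/
def SupportedOn (z : Equiv.Perm ℤ) (m : ℕ) : Prop :=
  ∀ x : ℤ, x < 1 ∨ (m : ℤ) < x → z x = x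
/-! ## Primed compatible sequences -/

/-- A primed compatible sequence, recorded as the list of its columns `(index; value)`. -/
def IsPrimedCompatible (φ : List (ℕ × Letter)) : Prop :=
  (∀ p ∈ φ, 0 < p.1 ∧ 0 < p.2.ceil) ∧
  List.Chain' (fun p q : ℕ × Letter => p.1 ≤ q.1 ∧ (p.1 = q.1 → p.2 ≤ q.2)) φ ∧
  (∀ (k l : ℕ) (p : ℕ × Letter), k < l → φ[k]? = some p → φ[l]? = some p →
    p.2.primed = false)

def IsIndexStrict (φ : List (ℕ × Letter)) : Prop :=
  List.Chain' (fun p q : ℕ × Letter => p.1 < q.1) φ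

/-! ## Sagan–Worley insertion (orthogonal and symplectic versions) -/

/-- Whether `u` bumps `v`: strict comparison when inserting an unprimed letter into a
row or a primed letter into a column, weak comparison otherwise. -/
def swBump (isRow : Bool) (u v : Letter) : Bool :=
  if (isRow && !u.primed) || (!isRow && u.primed) then decide (u < v) else decide (u ≤ v)

/-- Column stage of orthogonal Sagan–Worley insertion. -/
def swColO : ℕ → STab → ℕ → Letter → STab × Bool
  | 0, T, _, _ => (T, true)
  | fuel + 1, T, c, u =>
    let occ := (List.range (c + 1)).filterMap (fun r => (entry? T r c).map (fun x => (r, x)))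
    match occ.find? (fun p => swBump false u p.2) with
    | none =>
        let r := occ.length
        let u' := if r = c ∧ u.primed then Letter.unprime u else u
        (setRowG T r ((T.getD r []) ++ [u']), true)
    | some p =>
        if p.1 = c then
          if u.ceil = p.2.ceil then swColO fuel T (c + 1) (Letter.unprime p.2)
          else
            let q := switchPrimes u p.2
            swColO fuel (setEntryG T p.1 c q.1) (c + 1) q.2
        else swColO fuel (setEntryG T p.1 c u) (c + 1) p.2

/-- Row stage of orthogonal Sagan–Worley insertion. -/
def swRowO : ℕ → STab → ℕ → Letter → STab × Bool
  | 0, T, _, _ => (T, true)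
  | fuel + 1, T, r, u =>
    let row := T.getD r []
    match row.findIdx? (fun v => swBump true u v) with
    | none =>
        if row.isEmpty ∧ u.primed then (setRowG T r [Letter.unprime u], true)
        else (setRowG T r (row ++ [u]), false)
    | some k =>
        let v := row.getD k default
        if k = 0 then
          if u.ceil = v.ceil then swColO fuel T (r + 1) (Letter.unprime v)
          else
            let q := switchPrimes u v
            swColO fuel (setRowG T r (row.set 0 q.1)) (r + 1) q.2
        else swRowO fuel (setRowG T r (row.set k u)) (r + 1) v

def swInsertO (T : STab) (u : Letter) : STab × Bool :=
  swRowO (T.flatten.length + T.length + 2) T 0 u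

/-- Column stage of symplectic (original) Sagan–Worley insertion. -/
def swColSp : ℕ → STab → ℕ → Letter → STab × Bool
  | 0, T, _, _ => (T, true)
  | fuel + 1, T, c, u =>
    let occ := (List.range (c + 1)).filterMap (fun r => (entry? T r c).map (fun x => (r, x)))
    match occ.find? (fun p => swBump false u p.2) with
    | none => (setRowG T occ.length ((T.getD occ.length []) ++ [u]), true)
    | some p =>
        if p.1 = c then
          if u.ceil = p.2.ceil then swColSp fuel T (c + 1) (Letter.unprime p.2)
          else swColSp fuel (setEntryG T p.1 c u) (c + 1) p.2
        else swColSp fuel (setEntryG T p.1 c u) (c + 1) p.2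

/-- Row stage of symplectic (original) Sagan–Worley insertion. -/
def swRowSp : ℕ → STab → ℕ → Letter → STab × Bool
  | 0, T, _, _ => (T, true)
  | fuel + 1, T, r, u =>
    let row := T.getD r []
    match row.findIdx? (fun v => swBump true u v) with
    | none => (setRowG T r (row ++ [u]), false)
    | some k =>
        let v := row.getD k default
        if k = 0 then
          if u.ceil = v.ceil then swColSp fuel T (r + 1) (Letter.unprime v)
          else swColSp fuel (setRowG T r (row.set 0 u)) (r + 1) v
        else swRowSp fuel (setRowG T r (row.set k u)) (r + 1) v

def swInsertSp (T : STab) (u : Letter) : STab × Bool :=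
  swRowSp (T.flatten.length + T.length + 2) T 0 u

def PSWO (φ : List (ℕ × Letter)) : STab := φ.foldl (fun T p => (swInsertO T p.2).1) []

def PSWSp (φ : List (ℕ × Letter)) : STab := φ.foldl (fun T p => (swInsertSp T p.2).1) []

def QSWaux (ins : STab → Letter → STab × Bool) : STab → STab → List (ℕ × Letter) → STab
  | _, Q, [] => Q
  | P, Q, p :: rest =>
      let res := ins P p.2
      QSWaux ins res.1 (addBox Q P res.1 ⟨(p.1 : ℤ), res.2⟩) rest

def QSWO (φ : List (ℕ × Letter)) : STab := QSWaux swInsertO [] [] φ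

def QSWSp (φ : List (ℕ × Letter)) : STab := QSWaux swInsertSp [] [] φ

/-- Entry `A_{ij}` of the circled matrix of `φ` (forgetting the circles). -/
def cmEntry (φ : List (ℕ × Letter)) (i j : ℕ) : ℕ :=
  φ.countP (fun p => decide (p.1 = i ∧ p.2.ceil = (j : ℤ)))

/-! ## Shifted mixed insertion (orthogonal and symplectic versions) -/

/-- Tableaux whose entries are signed letters `(ε, u)`, `ε ∈ {+, -}`
(`true` records the sign `-`). -/
abbrev MTab := List (List (Bool × Letter))

def extractO (U : MTab) : STab :=
  U.map (fun row =>
    match row with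
    | [] => []
    | (e, x) :: rest => (if e then (⟨x.ceil, true⟩ : Letter) else x) :: rest.map Prod.snd)

def extractSp (U : MTab) : STab := U.map (List.map Prod.snd)

/-- One mixed insertion, of the pair `β` into row (`isCol = false`) or column
(`isCol = true`) number `idx`; returns the tableau and the added box. -/
def hmIns (sympl : Bool) : ℕ → MTab → Bool → ℕ → Bool × Letter → MTab × (ℕ × ℕ)
  | 0, T, _, _, _ => (T, (0, 0))
  | fuel + 1, T, isCol, idx, β =>
    if isCol then
      let c := idx
      let occ := (List.range (c + 1)).filterMap
        (fun r => (entryG? T r c).map (fun x => (r, x)))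
      match occ.find? (fun p => decide (β.2 < p.2.2)) with
      | none =>
          let r := occ.length
          (setRowG T r ((T.getD r []) ++ [β]), (r, c))
      | some p =>
          if p.1 = c then
            hmIns sympl fuel
              (setEntryG T p.1 c (if sympl then (p.2.1, β.2) else β)) true (c + 1)
              (if sympl then (β.1, ⟨p.2.2.ceil, true⟩) else (p.2.1, ⟨p.2.2.ceil, true⟩))
          else
            hmIns sympl fuel (setEntryG T p.1 c (p.2.1, β.2)) p.2.2.primed
              (if p.2.2.primed then c + 1 else p.1 + 1) (β.1, p.2.2)
    else
      let r := idx
      let row := T.getD r []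
      match row.findIdx? (fun p => decide (β.2 < p.2)) with
      | none => (setRowG T r (row ++ [β]), (r, r + row.length))
      | some k =>
          let q := row.getD k default
          if k = 0 then
            hmIns sympl fuel
              (setRowG T r (row.set 0 (if sympl then (q.1, β.2) else β))) true (r + 1)
              (if sympl then (β.1, ⟨q.2.ceil, true⟩) else (q.1, ⟨q.2.ceil, true⟩))
          else
            hmIns sympl fuel (setRowG T r (row.set k (q.1, β.2))) q.2.primed
              (if q.2.primed then r + k + 1 else r + 1) (β.1, q.2)

def hmInsert (sympl : Bool) (T : MTab) (x : Letter) : MTab × (ℕ × ℕ) :=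
  hmIns sympl (2 * T.flatten.length + 4) T false 0 (x.primed, ⟨x.ceil, false⟩)

def hmAuxCS (sympl : Bool) : MTab → STab → List (ℕ × Letter) → MTab × STab
  | U, Q, [] => (U, Q)
  | U, Q, p :: rest =>
      let res := hmInsert sympl U p.2
      let pos := res.2
      let sgn := ((entryG? res.1 pos.1 pos.2).map Prod.fst).getD false
      let pr : Bool := if sympl then sgn else (decide (pos.1 ≠ pos.2) && sgn)
      hmAuxCS sympl res.1
        (setRowG Q pos.1 ((Q.getD pos.1 []) ++ [(⟨(p.1 : ℤ), pr⟩ : Letter)])) rest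

def PHMO (φ : List (ℕ × Letter)) : STab := extractO (hmAuxCS false [] [] φ).1
def QHMO (φ : List (ℕ × Letter)) : STab := (hmAuxCS false [] [] φ).2
def PHMSp (φ : List (ℕ × Letter)) : STab := extractSp (hmAuxCS true [] [] φ).1
def QHMSp (φ : List (ℕ × Letter)) : STab := (hmAuxCS true [] [] φ).2

/-- A primed word, identified with the primed compatible sequence with
index row `1, 2, …, n`. -/
def wordCS (a : PWord) : List (ℕ × Letter) :=
  ((List.range a.length).zip a).map (fun p => (p.1 + 1, p.2))

/-! ## The transpose of a primed compatible sequence -/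

def insSortedCS (p : ℕ × Letter) : List (ℕ × Letter) → List (ℕ × Letter)
  | [] => [p]
  | q :: rest =>
      if p.1 < q.1 ∨ (p.1 = q.1 ∧ p.2 ≤ q.2) then p :: q :: rest
      else q :: insSortedCS p rest

def sortCS (l : List (ℕ × Letter)) : List (ℕ × Letter) := l.foldr insSortedCS []

/-- `φ^⊤`: move each prime from the value to the index above it, interchange the two
rows, and reorder the columns lexicographically. -/
def transposeCS (φ : List (ℕ × Letter)) : List (ℕ × Letter) :=
  sortCS (φ.map (fun p => (p.2.ceil.toNat, (⟨(p.1 : ℤ), p.2.primed⟩ : Letter))))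

/-! ## Demazure action on involutions -/

theorem sPerm_apply (i x : ℤ) :
    sPerm i x = if x = i then i + 1 else if x = i + 1 then i else x := by
  simp only [sPerm, Equiv.swap_apply_def]

theorem sPerm_inv (i : ℤ) : (sPerm i)⁻¹ = sPerm i := Equiv.swap_inv _ _

theorem sPerm_lt_iff {x a b : ℤ} (h₁ : ¬(a = x ∧ b = x + 1)) (h₂ : ¬(a = x + 1 ∧ b = x)) :
    sPerm x a < sPerm x b ↔ a < b := by
  simp only [sPerm_apply]
  split_ifs <;> omega

/-- The right Demazure action `σ ∘ s_i`. -/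
def rightStep (σ : Equiv.Perm ℤ) (i : ℤ) : Equiv.Perm ℤ :=
  if σ i < σ (i + 1) then σ * sPerm i else σ

/-- The left Demazure action `s_i ∘ σ`. -/
def leftStep (i : ℤ) (σ : Equiv.Perm ℤ) : Equiv.Perm ℤ :=
  if σ⁻¹ i < σ⁻¹ (i + 1) then sPerm i * σ else σ

theorem rightStep_leftStep (x y : ℤ) (σ : Equiv.Perm ℤ) :
    rightStep (leftStep x σ) y = leftStep x (rightStep σ y) := by
  have e₁ : σ y = x ↔ σ⁻¹ x = y := by rw [Equiv.Perm.inv_eq_iff_eq, eq_comm]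
  have e₂ : σ (y + 1) = x + 1 ↔ σ⁻¹ (x + 1) = y + 1 := by
    rw [Equiv.Perm.inv_eq_iff_eq, eq_comm]
  have e₃ : σ y = x + 1 ↔ σ⁻¹ (x + 1) = y := by rw [Equiv.Perm.inv_eq_iff_eq, eq_comm]
  have e₄ : σ (y + 1) = x ↔ σ⁻¹ x = y + 1 := by rw [Equiv.Perm.inv_eq_iff_eq, eq_comm]
  by_cases h₁ : σ y = x ∧ σ (y + 1) = x + 1
  · have hs : σ * sPerm y = sPerm x * σ := by
      rw [sPerm, sPerm, Equiv.mul_swap_eq_swap_mul, h₁.1, h₁.2]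
    have i₁ := e₁.1 h₁.1
    have i₂ := e₂.1 h₁.2
    have hr : rightStep σ y = σ * sPerm y := if_pos (by omega)
    have hl : leftStep x σ = sPerm x * σ := if_pos (by omega)
    rw [hr, hl, ← hs, rightStep, if_neg, hs, leftStep, if_neg]
    · rw [mul_inv_rev, sPerm_inv, Equiv.Perm.mul_apply, Equiv.Perm.mul_apply, sPerm_apply,
        sPerm_apply, if_pos rfl, if_neg (by omega), if_pos rfl]
      omega
    · rw [Equiv.Perm.mul_apply, Equiv.Perm.mul_apply, sPerm_apply,
        sPerm_apply, if_pos rfl, if_neg (by omega), if_pos rfl]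
      omega
  by_cases h₂ : σ y = x + 1 ∧ σ (y + 1) = x
  · have i₁ := e₃.1 h₂.1
    have i₂ := e₄.1 h₂.2
    have hr : rightStep σ y = σ := if_neg (by omega)
    have hl : leftStep x σ = σ := if_neg (by omega)
    rw [hl, hr, hl]
  have hA : ∀ τ, τ = σ ∨ τ = sPerm x * σ → (τ y < τ (y + 1) ↔ σ y < σ (y + 1)) := by
    rintro τ (rfl | rfl)
    · rfl
    · exact sPerm_lt_iff h₁ h₂
  have hB : ∀ τ, τ = σ ∨ τ = σ * sPerm y → (τ⁻¹ x < τ⁻¹ (x + 1) ↔ σ⁻¹ x < σ⁻¹ (x + 1)) := by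
    rintro τ (rfl | rfl)
    · rfl
    · rw [mul_inv_rev, sPerm_inv]
      refine sPerm_lt_iff ?_ ?_
      · rwa [← e₁, ← e₂]
      · rwa [← e₃, ← e₄, and_comm]
  unfold rightStep leftStep
  by_cases a : σ y < σ (y + 1) <;> by_cases b : σ⁻¹ x < σ⁻¹ (x + 1)
  · rw [if_pos b, if_pos a, if_pos ((hA _ (Or.inr rfl)).2 a), if_pos ((hB _ (Or.inr rfl)).2 b),
      mul_assoc]
  · rw [if_neg b, if_pos a, if_neg (mt (hB _ (Or.inr rfl)).1 b)]
  · rw [if_pos b, if_neg a, if_neg (mt (hA _ (Or.inr rfl)).1 a), if_pos b]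
  · rw [if_neg b, if_neg a, if_neg b]

theorem heckeProd_append_singleton (w : List ℤ) (x : ℤ) :
    heckeProd (w ++ [x]) = rightStep (heckeProd w) x := by
  simp only [heckeProd, List.foldl_append, List.foldl_cons, List.foldl_nil]
  rfl

theorem heckeProd_cons (x : ℤ) (w : List ℤ) :
    heckeProd (x :: w) = leftStep x (heckeProd w) := by
  induction w using List.reverseRecOn with
  | nil => simp [heckeProd, leftStep]
  | append_singleton w y ih =>
    rw [← List.cons_append, heckeProd_append_singleton, ih, rightStep_leftStep,
      heckeProd_append_singleton]

/-- The operation `z ↦ s_i ∘ z ∘ s_i`. -/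
def invStep (z : Equiv.Perm ℤ) (i : ℤ) : Equiv.Perm ℤ := leftStep i (rightStep z i)

theorem invHecke_append_singleton (a : List ℤ) (x : ℤ) :
    invHecke (a ++ [x]) = invStep (invHecke a) x := by
  cases a with
  | nil => simp [invHecke, heckeProd, invStep, rightStep, leftStep, sPerm_inv, sPerm_apply]
  | cons h t =>
    have e : (h :: t ++ [x]).reverse ++ (h :: t ++ [x]).tail =
        x :: (((h :: t).reverse ++ (h :: t).tail) ++ [x]) := by simp
    rw [invHecke, e, heckeProd_cons, heckeProd_append_singleton]
    rfl

theorem invHecke_append (a b : List ℤ) : invHecke (a ++ b) = b.foldl invStep (invHecke a) := by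
  induction b using List.reverseRecOn with
  | nil => simp
  | append_singleton b x ih =>
    rw [← List.append_assoc, invHecke_append_singleton, ih]
    simp

theorem invStep_of_not_lt {z : Equiv.Perm ℤ} (hz : z⁻¹ = z) {i : ℤ} (h : ¬ z i < z (i + 1)) :
    invStep z i = z := by
  rw [invStep, rightStep, if_neg h, leftStep, hz, if_neg h]

theorem invStep_of_fixed {z : Equiv.Perm ℤ} (hz : z⁻¹ = z) {i : ℤ}
    (h : z i = i ∧ z (i + 1) = i + 1) : invStep z i = z * sPerm i := by
  rw [invStep, rightStep, if_pos (by omega), leftStep, if_neg]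
  simp [sPerm_inv, hz, h, sPerm_apply]

theorem invStep_of_not_fixed {z : Equiv.Perm ℤ} (hz : z⁻¹ = z) {i : ℤ}
    (hlt : z i < z (i + 1)) (h : ¬(z i = i ∧ z (i + 1) = i + 1)) :
    invStep z i = sPerm i * (z * sPerm i) := by
  rw [invStep, rightStep, if_pos hlt, leftStep, if_pos]
  rw [mul_inv_rev, sPerm_inv, hz]
  exact (sPerm_lt_iff h (by omega)).2 hlt

theorem invStep_cases {z : Equiv.Perm ℤ} (hz : z⁻¹ = z) (i : ℤ) :
    (¬ z i < z (i + 1) ∧ invStep z i = z) ∨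
    ((z i = i ∧ z (i + 1) = i + 1) ∧ invStep z i = z * sPerm i) ∨
    (z i < z (i + 1) ∧ ¬(z i = i ∧ z (i + 1) = i + 1) ∧
      invStep z i = sPerm i * (z * sPerm i)) := by
  by_cases h : z i < z (i + 1)
  · by_cases h' : z i = i ∧ z (i + 1) = i + 1
    · exact Or.inr (Or.inl ⟨h', invStep_of_fixed hz h'⟩)
    · exact Or.inr (Or.inr ⟨h, h', invStep_of_not_fixed hz h h'⟩)
  · exact Or.inl ⟨h, invStep_of_not_lt hz h⟩

theorem apply_apply_of_inv_eq {z : Equiv.Perm ℤ} (hz : z⁻¹ = z) (x : ℤ) : z (z x) = x := by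
  rw [← Equiv.Perm.mul_apply, eq_inv_iff_mul_eq_one.1 hz.symm, Equiv.Perm.one_apply]

theorem inv_invStep {z : Equiv.Perm ℤ} (hz : z⁻¹ = z) (i : ℤ) :
    (invStep z i)⁻¹ = invStep z i := by
  rcases invStep_cases hz i with ⟨-, e⟩ | ⟨h, e⟩ | ⟨-, -, e⟩
  · rw [e, hz]
  · rw [e, mul_inv_rev, sPerm_inv, hz, sPerm, Equiv.mul_swap_eq_swap_mul, h.1, h.2]
  · rw [e, mul_inv_rev, mul_inv_rev, sPerm_inv, hz, mul_assoc]

theorem inv_invHecke (a : List ℤ) : (invHecke a)⁻¹ = invHecke a := by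
  induction a using List.reverseRecOn with
  | nil => simp [invHecke, heckeProd]
  | append_singleton a x ih => rw [invHecke_append_singleton, inv_invStep ih]

theorem invStep_succ_lt {z : Equiv.Perm ℤ} (hz : z⁻¹ = z) (i : ℤ) :
    invStep z i (i + 1) < invStep z i i := by
  rcases invStep_cases hz i with ⟨h, e⟩ | ⟨h, e⟩ | ⟨h, h', e⟩
  · have : z i ≠ z (i + 1) := fun hh => by
      have := z.injective hh
      omega
    rw [e]
    omega
  · simp [e, h, sPerm_apply]
  · rw [e]
    simp only [Equiv.Perm.mul_apply]
    rw [sPerm_apply i i, sPerm_apply i (i + 1), if_pos rfl, if_neg (by omega), if_pos rfl]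
    exact (sPerm_lt_iff h' (by omega)).2 h

theorem invStep_fixed {z : Equiv.Perm ℤ} (hz : z⁻¹ = z) {i x : ℤ} (hx : z x = x)
    (h₁ : x ≠ i) (h₂ : x ≠ i + 1) : invStep z i x = x := by
  rcases invStep_cases hz i with ⟨-, e⟩ | ⟨-, e⟩ | ⟨-, -, e⟩ <;>
    simp [e, sPerm_apply, h₁, h₂, hx]

theorem invStep_descent {z : Equiv.Perm ℤ} (hz : z⁻¹ = z) {i j : ℤ}
    (hi : z (i + 1) < z i) (hj : j ≤ i - 2 ∨ i + 2 ≤ j) :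
    invStep z j (i + 1) < invStep z j i := by
  have f₁ : sPerm j i = i := by rw [sPerm_apply, if_neg (by omega), if_neg (by omega)]
  have f₂ : sPerm j (i + 1) = i + 1 := by
    rw [sPerm_apply, if_neg (by omega), if_neg (by omega)]
  rcases invStep_cases hz j with ⟨h, e⟩ | ⟨h, e⟩ | ⟨h, h', e⟩
  · rwa [e]
  · simpa [e, f₁, f₂] using hi
  · simp only [e, Equiv.Perm.mul_apply, f₁, f₂]
    refine (sPerm_lt_iff ?_ (by omega)).2 hi
    rintro ⟨g₁, g₂⟩
    have k₁ := apply_apply_of_inv_eq hz (i + 1)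
    have k₂ := apply_apply_of_inv_eq hz i
    rw [g₁] at k₁
    rw [g₂] at k₂
    omega

theorem invHecke_append_descent {a b : List ℤ} {i : ℤ}
    (ha : invHecke a (i + 1) < invHecke a i) (hb : ∀ j ∈ b, j ≤ i - 2 ∨ i + 2 ≤ j) :
    invHecke (a ++ b) (i + 1) < invHecke (a ++ b) i := by
  induction b using List.reverseRecOn with
  | nil => simpa using ha
  | append_singleton b x ih =>
    rw [← List.append_assoc, invHecke_append_singleton]
    exact invStep_descent (inv_invHecke _) (ih fun j hj => hb j (by simp [hj])) (hb x (by simp))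

theorem invHecke_append_fixed {a b : List ℤ} {x : ℤ}
    (ha : invHecke a x = x) (hb : ∀ j ∈ b, x ≠ j ∧ x ≠ j + 1) :
    invHecke (a ++ b) x = x := by
  induction b using List.reverseRecOn with
  | nil => simpa using ha
  | append_singleton b y ih =>
    rw [← List.append_assoc, invHecke_append_singleton]
    have := hb y (by simp)
    exact invStep_fixed (inv_invHecke _) (ih fun j hj => hb j (by simp [hj])) this.1 this.2

theorem invHecke_fixed {b : List ℤ} {x : ℤ} (hb : ∀ j ∈ b, x ≠ j ∧ x ≠ j + 1) :
    invHecke b x = x :=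
  invHecke_append_fixed (a := []) (by simp [invHecke, heckeProd]) hb

theorem invStep_apply_far {z : Equiv.Perm ℤ} (hz : z⁻¹ = z) {i j : ℤ}
    (hi : z i = i + 1) (hj : j ≤ i - 2 ∨ i + 2 ≤ j) : invStep z j i = i + 1 := by
  have f₁ : sPerm j i = i := by rw [sPerm_apply, if_neg (by omega), if_neg (by omega)]
  have f₂ : sPerm j (i + 1) = i + 1 := by
    rw [sPerm_apply, if_neg (by omega), if_neg (by omega)]
  rcases invStep_cases hz j with ⟨-, e⟩ | ⟨-, e⟩ | ⟨-, -, e⟩ <;> simp [e, f₁, f₂, hi]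

theorem invHecke_append_swapped {a b : List ℤ} {i : ℤ}
    (ha : invHecke a i = i + 1) (hb : ∀ j ∈ b, j ≤ i - 2 ∨ i + 2 ≤ j) :
    invHecke (a ++ b) i = i + 1 := by
  induction b using List.reverseRecOn with
  | nil => simpa using ha
  | append_singleton b x ih =>
    rw [← List.append_assoc, invHecke_append_singleton]
    exact invStep_apply_far (inv_invHecke _) (ih fun j hj => hb j (by simp [hj]))
      (hb x (by simp))

theorem invHecke_append_singleton_swapped {a : List ℤ} {i : ℤ}
    (h : invHecke a i = i ∧ invHecke a (i + 1) = i + 1) :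
    invHecke (a ++ [i]) i = i + 1 ∧ invHecke (a ++ [i]) (i + 1) = i := by
  rw [invHecke_append_singleton, invStep_of_fixed (inv_invHecke _) h]
  simp [sPerm_apply, h]

/-! ## Local constraints on primed involution words -/

/-- Every letter of the word is an ascent of the involution of the preceding prefix, and primed
letters are commutations. -/
structure IsReducedPrimed (a : PWord) : Prop where
  ascent : ∀ p x q, a = p ++ x :: q →
    invHecke (unprimeWord p) x.ceil < invHecke (unprimeWord p) (x.ceil + 1)
  fixed : ∀ p x q, a = p ++ x :: q → x.primed = true →
    invHecke (unprimeWord p) x.ceil = x.ceil ∧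
      invHecke (unprimeWord p) (x.ceil + 1) = x.ceil + 1

theorem isReducedPrimed_of_mem {z : Equiv.Perm ℤ} {a : PWord} (h : a ∈ RinvPlus z) :
    IsReducedPrimed a := by
  obtain ⟨⟨h₁, h₂⟩, h₃⟩ := h
  constructor
  · rintro p x q rfl
    by_contra hlt
    have e : unprimeWord (p ++ x :: q) = unprimeWord p ++ [x.ceil] ++ unprimeWord q := by
      simp [unprimeWord]
    have hs : invHecke (unprimeWord p ++ unprimeWord q) = z := by
      rw [← h₁, e, invHecke_append, invHecke_append (_ ++ _), invHecke_append_singleton,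
        invStep_of_not_lt (inv_invHecke _) hlt]
    have := h₂ _ hs
    simp [unprimeWord] at this
  · rintro p x q rfl hx
    obtain ⟨y, hy, hf⟩ := h₃ p.length x (by simp) hx
    have : y = x.ceil := by simpa [unprimeWord] using hy.symm
    subst this
    simpa [unprimeWord] using hf

namespace IsReducedPrimed

theorem false_of_far {a : PWord} (h : IsReducedPrimed a)
    {p m q : PWord} {x y : Letter} (ha : a = p ++ x :: (m ++ y :: q))
    (hxy : x.ceil = y.ceil)
    (hm : ∀ w ∈ m, w.ceil ≤ x.ceil - 2 ∨ x.ceil + 2 ≤ w.ceil) : False := by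
  have := h.ascent (p ++ x :: m) y q (by simp [ha])
  have e : unprimeWord (p ++ x :: m) = (unprimeWord p ++ [x.ceil]) ++ unprimeWord m := by
    simp [unprimeWord]
  have h₁ : invHecke (unprimeWord p ++ [x.ceil]) (x.ceil + 1) <
      invHecke (unprimeWord p ++ [x.ceil]) x.ceil := by
    rw [invHecke_append_singleton]
    exact invStep_succ_lt (inv_invHecke _) _
  have h₂ := invHecke_append_descent h₁ (b := unprimeWord m) (by
    simpa [unprimeWord] using hm)
  rw [← e, hxy] at h₂
  omega

theorem ceil_ne_of_adjacent {a : PWord} (h : IsReducedPrimed a)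
    {p q : PWord} {x y : Letter} (ha : a = p ++ x :: y :: q) :
    x.ceil ≠ y.ceil :=
  fun hxy => h.false_of_far (m := []) ha hxy (by simp)

theorem false_of_adjacent_primed {a : PWord} (h : IsReducedPrimed a)
    {p q : PWord} {x y : Letter} (ha : a = p ++ x :: y :: q)
    (hx : x.primed = true) (hy : y.primed = true)
    (hxy : x.ceil = y.ceil + 1 ∨ y.ceil = x.ceil + 1) : False := by
  obtain ⟨h₁, h₂⟩ := invHecke_append_singleton_swapped (h.fixed p x (y :: q) ha hx)
  obtain ⟨h₃, h₄⟩ := h.fixed (p ++ [x]) y q (by simp [ha]) hy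
  have e : unprimeWord (p ++ [x]) = unprimeWord p ++ [x.ceil] := by simp [unprimeWord]
  rw [e] at h₃ h₄
  rcases hxy with hxy | hxy
  · rw [hxy] at h₁ h₃ h₄
    rw [hxy] at h₂
    omega
  · rw [hxy] at h₃ h₄
    omega

theorem false_of_large_start {a : PWord} (h : IsReducedPrimed a)
    {p m q : PWord} {x w y : Letter}
    (ha : a = p ++ x :: (m ++ w :: y :: q)) (hxy : x.ceil = y.ceil)
    (hw : w.ceil = y.ceil - 1) (hy : y.primed = true)
    (hp : ∀ v ∈ p, y.ceil + 2 ≤ v.ceil) (hm : ∀ v ∈ m, y.ceil + 2 ≤ v.ceil) : False := by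
  obtain ⟨-, hf⟩ := h.fixed (p ++ x :: (m ++ [w])) y q (by simp [ha]) hy
  have e : unprimeWord (p ++ x :: (m ++ [w])) =
      (unprimeWord p ++ [y.ceil] ++ unprimeWord m) ++ [y.ceil - 1] := by
    simp [unprimeWord, hxy, hw]
  have hp' : ∀ j ∈ unprimeWord p, y.ceil + 2 ≤ j := by simpa [unprimeWord] using hp
  have hm' : ∀ j ∈ unprimeWord m, y.ceil + 2 ≤ j := by simpa [unprimeWord] using hm
  have g₁ : invHecke (unprimeWord p ++ [y.ceil]) y.ceil = y.ceil + 1 :=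
    (invHecke_append_singleton_swapped ⟨invHecke_fixed fun j hj => by have := hp' j hj; omega,
      invHecke_fixed fun j hj => by have := hp' j hj; omega⟩).1
  have g₂ := invHecke_append_swapped g₁ (b := unprimeWord m)
    fun j hj => Or.inr (hm' j hj)
  have g₃ : invHecke (unprimeWord p ++ [y.ceil] ++ unprimeWord m) (y.ceil - 1) =
      y.ceil - 1 := by
    refine invHecke_fixed fun j hj => ?_
    simp only [List.mem_append, List.mem_singleton] at hj
    rcases hj with (hj | hj) | hj
    · have := hp' j hj; omega
    · omega
    · have := hm' j hj; omega
  have hz := inv_invHecke (unprimeWord p ++ [y.ceil] ++ unprimeWord m)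
  have g₄ := apply_apply_of_inv_eq hz y.ceil
  rw [g₂] at g₄
  rw [e, invHecke_append_singleton, invStep_of_not_fixed hz (by rw [sub_add_cancel]; omega)
    (by rw [sub_add_cancel]; omega)] at hf
  simp only [Equiv.Perm.mul_apply] at hf
  rw [sPerm_apply _ (y.ceil + 1), if_neg (by omega), if_neg (by omega), g₄, sPerm_apply,
    if_neg (by omega), if_pos (by omega)] at hf
  omega

theorem false_of_small_start {a : PWord} (h : IsReducedPrimed a)
    {p m q : PWord} {x w y : Letter}
    (ha : a = p ++ x :: (m ++ w :: y :: q)) (hxy : x.ceil = y.ceil)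
    (hw : w.ceil = x.ceil + 1) (hx : x.primed = true)
    (hp : ∀ v ∈ p, v.ceil ≤ x.ceil - 2) (hm : ∀ v ∈ m, v.ceil ≤ x.ceil - 2) : False := by
  have hasc := h.ascent (p ++ x :: (m ++ [w])) y q (by simp [ha])
  have e : unprimeWord (p ++ x :: (m ++ [w])) =
      (unprimeWord p ++ [x.ceil] ++ unprimeWord m) ++ [x.ceil + 1] := by
    simp [unprimeWord, hw]
  have hp' : ∀ j ∈ unprimeWord p, j ≤ x.ceil - 2 := by simpa [unprimeWord] using hp
  have hm' : ∀ j ∈ unprimeWord m, j ≤ x.ceil - 2 := by simpa [unprimeWord] using hm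
  have g₁ := (invHecke_append_singleton_swapped (h.fixed p x _ ha hx)).1
  have g₂ := invHecke_append_swapped g₁ (b := unprimeWord m)
    fun j hj => Or.inl (hm' j hj)
  have g₃ : invHecke (unprimeWord p ++ [x.ceil] ++ unprimeWord m) (x.ceil + 2) =
      x.ceil + 2 := by
    refine invHecke_fixed fun j hj => ?_
    simp only [List.mem_append, List.mem_singleton] at hj
    rcases hj with (hj | hj) | hj
    · have := hp' j hj; omega
    · omega
    · have := hm' j hj; omega
  have hz := inv_invHecke (unprimeWord p ++ [x.ceil] ++ unprimeWord m)
  have g₄ := apply_apply_of_inv_eq hz x.ceil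
  rw [g₂] at g₄
  have a₁ : x.ceil + 1 + 1 = x.ceil + 2 := by omega
  rw [e, ← hxy, invHecke_append_singleton, invStep_of_not_fixed hz (by rw [a₁]; omega)
    (by omega)] at hasc
  simp only [Equiv.Perm.mul_apply] at hasc
  have k₁ : sPerm (x.ceil + 1) x.ceil = x.ceil := by
    rw [sPerm_apply, if_neg (by omega), if_neg (by omega)]
  have k₂ : sPerm (x.ceil + 1) (x.ceil + 1) = x.ceil + 2 := by
    rw [sPerm_apply, if_pos rfl, a₁]
  have k₃ : sPerm (x.ceil + 1) (x.ceil + 2) = x.ceil + 1 := by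
    rw [sPerm_apply, if_neg (by omega), if_pos a₁.symm]
  rw [k₁, g₂, k₂, g₃, k₃] at hasc
  omega

end IsReducedPrimed

/-! ## Order on letters -/

namespace Letter

theorem lt_iff {x y : Letter} :
    x < y ↔ x.ceil < y.ceil ∨ x.ceil = y.ceil ∧ x.primed = true ∧ y.primed = false := by
  have : x < y ↔ toLex (x.ceil, !x.primed) < toLex (y.ceil, !y.primed) := Iff.rfl
  rw [this, Prod.Lex.toLex_lt_toLex]
  cases x.primed <;> cases y.primed <;> simp

theorem ceil_le_of_lt {x y : Letter} (h : x < y) : x.ceil ≤ y.ceil := by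
  rcases lt_iff.1 h with h | h <;> omega

theorem ceil_le_of_le {x y : Letter} (h : x ≤ y) : x.ceil ≤ y.ceil := by
  rcases h.lt_or_eq with h | rfl
  · exact ceil_le_of_lt h
  · rfl

theorem ceil_lt_of_lt_of_ne {x y : Letter} (h : x < y) (hne : x.ceil ≠ y.ceil) :
    x.ceil < y.ceil :=
  lt_of_le_of_ne (ceil_le_of_lt h) hne

theorem primed_of_lt_of_ceil_eq {x y : Letter} (h : x < y) (he : x.ceil = y.ceil) :
    x.primed = true := by
  rcases lt_iff.1 h with h | h
  · omega
  · exact h.2.1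

end Letter

/-! ## Entries of shifted tableaux -/

theorem entry?_eq_some {T : STab} {r c : ℕ} {x : Letter} :
    entry? T r c = some x ↔ r ≤ c ∧ ∃ row, T[r]? = some row ∧ row[c - r]? = some x := by
  unfold entry? entryG?
  split_ifs with h <;> simp [h, Option.bind_eq_some_iff]

theorem entry?_unprimeT (T : STab) (r c : ℕ) :
    entry? (unprimeT T) r c = (entry? T r c).map Letter.unprime := by
  unfold entry? entryG? unprimeT
  split_ifs with h
  · rw [List.getElem?_map]
    cases T[r]? <;> simp
  · rfl

theorem exists_entry_left {T : STab} {r c : ℕ} {y : Letter} (hrc : r ≤ c)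
    (h : entry? T r (c + 1) = some y) : ∃ x, entry? T r c = some x := by
  obtain ⟨-, row, hrow, hy⟩ := entry?_eq_some.1 h
  obtain ⟨hc, -⟩ := List.getElem?_eq_some_iff.1 hy
  exact ⟨row[c - r]'(by omega), entry?_eq_some.2
    ⟨hrc, row, hrow, List.getElem?_eq_getElem _⟩⟩

namespace IsShifted

theorem exists_entry_below {T : STab} (hT : IsShifted T) {r c : ℕ} {y : Letter} (h : entry? T
    (r + 1) c = some y) :
    ∃ x, entry? T r c = some x := by
  obtain ⟨hrc, row, hrow, hy⟩ := entry?_eq_some.1 h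
  obtain ⟨hr, rfl⟩ := List.getElem?_eq_some_iff.1 hrow
  obtain ⟨hc, -⟩ := List.getElem?_eq_some_iff.1 hy
  have hlt : T[r + 1].length < T[r].length := by
    have := List.isChain_iff_getElem.1 hT.1 r (by simpa [shapeOf] using hr)
    simpa [shapeOf] using this
  exact ⟨T[r][c - r]'(by omega), entry?_eq_some.2
    ⟨by omega, T[r], List.getElem?_eq_getElem _, List.getElem?_eq_getElem _⟩⟩

theorem exists_entry_le_row {T : STab} (hT : IsShifted T) (hI : IsIncreasing T) {r c : ℕ} (k : ℕ)
    {y : Letter}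
    (h : entry? T (r + k) c = some y) : ∃ x, entry? T r c = some x ∧ x ≤ y := by
  induction k generalizing y with
  | zero => exact ⟨y, h, le_rfl⟩
  | succ k ih =>
    obtain ⟨x, hx⟩ := hT.exists_entry_below h
    obtain ⟨w, hw, hle⟩ := ih hx
    exact ⟨w, hw, hle.trans (hI.2 _ _ _ _ hx h).le⟩

/-- Every box weakly southwest of an occupied box is occupied by a weakly smaller letter. -/
theorem exists_entry_le {T : STab} (hT : IsShifted T) (hI : IsIncreasing T) {r c r' c' : ℕ}
    {y : Letter} (hrc : r ≤ c)
    (hr : r ≤ r') (hc : c ≤ c') (h : entry? T r' c' = some y) :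
    ∃ x, entry? T r c = some x ∧ x ≤ y := by
  obtain ⟨k, rfl⟩ := Nat.exists_eq_add_of_le hr
  obtain ⟨l, rfl⟩ := Nat.exists_eq_add_of_le hc
  obtain ⟨x, hx, hxy⟩ := hT.exists_entry_le_row hI k h
  suffices H : ∀ l x, entry? T r (c + l) = some x → ∃ w, entry? T r c = some w ∧ w ≤ x by
    obtain ⟨w, hw, hwx⟩ := H l x hx
    exact ⟨w, hw, hwx.trans hxy⟩
  intro l
  induction l with
  | zero => exact fun x hx => ⟨x, hx, le_rfl⟩
  | succ l ih =>
    intro x hx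
    obtain ⟨w, hw⟩ := exists_entry_left (hrc.trans (Nat.le_add_right _ _)) hx
    obtain ⟨v, hv, hvw⟩ := ih w hw
    exact ⟨v, hv, hvw.trans (hI.1 _ _ _ _ hw hx).le⟩

theorem le_of_entry {T : STab} (hT : IsShifted T) (hI : IsIncreasing T) {r c r' c' : ℕ}
    {x y : Letter}
    (hr : r ≤ r') (hc : c ≤ c') (hx : entry? T r c = some x) (h : entry? T r' c' = some y) :
    x ≤ y := by
  obtain ⟨w, hw, hwy⟩ := hT.exists_entry_le hI (entry?_eq_some.1 hx).1 hr hc h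
  rw [hx] at hw
  exact (Option.some.inj hw) ▸ hwy

end IsShifted

/-! ## The row reading word -/

/-- The letters of row `r` from column `r + k` on. -/
def rowFrom (T : STab) (r k : ℕ) : PWord := ((T[r]?).getD []).drop k

/-- The letters of row `r` before column `r + k`. -/
def rowBefore (T : STab) (r k : ℕ) : PWord := ((T[r]?).getD []).take k

/-- The part of the row reading word that comes from row `r` on. -/
def rowWordFrom (T : STab) (r : ℕ) : PWord := (T.drop r).reverse.flatten

theorem rowWordFrom_eq (T : STab) (r : ℕ) :
    rowWordFrom T r = rowWordFrom T (r + 1) ++ (T[r]?).getD [] := by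
  unfold rowWordFrom
  by_cases h : r < T.length
  · rw [List.drop_eq_getElem_cons h, List.reverse_cons, List.flatten_append,
      List.getElem?_eq_getElem h]
    simp
  · rw [List.drop_eq_nil_of_le (by omega), List.drop_eq_nil_of_le (by omega)]
    simp [h]

theorem exists_rowWord_eq (T : STab) (r : ℕ) : ∃ q, rowWord T = rowWordFrom T r ++ q := by
  induction r with
  | zero => exact ⟨[], by simp [rowWord, rowWordFrom]⟩
  | succ r ih =>
    obtain ⟨q, hq⟩ := ih
    exact ⟨(T[r]?).getD [] ++ q, by rw [hq, rowWordFrom_eq, List.append_assoc]⟩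

theorem exists_entry_of_mem_rowWordFrom {T : STab} {r : ℕ} {x : Letter}
    (h : x ∈ rowWordFrom T r) : ∃ r' c', r ≤ r' ∧ entry? T r' c' = some x := by
  obtain ⟨row, hrow, hx⟩ := List.mem_flatten.1 h
  obtain ⟨i, hi⟩ := List.mem_iff_getElem?.1 (List.mem_reverse.1 hrow)
  obtain ⟨j, hj⟩ := List.mem_iff_getElem?.1 hx
  rw [List.getElem?_drop] at hi
  exact ⟨r + i, r + i + j, by omega, entry?_eq_some.2 ⟨by omega, row, hi, by simpa using hj⟩⟩

theorem row_eq_of_entry {T : STab} {r c : ℕ} {x : Letter} (h : entry? T r c = some x) :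
    (T[r]?).getD [] = rowBefore T r (c - r) ++ x :: rowFrom T r (c - r + 1) := by
  obtain ⟨-, row, hrow, hx⟩ := entry?_eq_some.1 h
  obtain ⟨hc, rfl⟩ := List.getElem?_eq_some_iff.1 hx
  rw [rowBefore, rowFrom, hrow, Option.getD_some, ← List.drop_eq_getElem_cons,
    List.take_append_drop]

theorem rowBefore_eq_of_entry {T : STab} {r c : ℕ} {x : Letter} (h : entry? T r c = some x) :
    rowBefore T r (c + 1 - r) = rowBefore T r (c - r) ++ [x] := by
  obtain ⟨hrc, row, hrow, hx⟩ := entry?_eq_some.1 h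
  obtain ⟨hc, rfl⟩ := List.getElem?_eq_some_iff.1 hx
  rw [rowBefore, rowBefore, hrow, Option.getD_some, Nat.succ_sub hrc,
    List.take_succ_eq_append_getElem hc]

theorem rowFrom_eq_of_entry {T : STab} {r c : ℕ} {x : Letter} (h : entry? T r c = some x) :
    rowFrom T r (c - r) = x :: rowFrom T r (c - r + 1) := by
  obtain ⟨hrc, row, hrow, hx⟩ := entry?_eq_some.1 h
  obtain ⟨hc, rfl⟩ := List.getElem?_eq_some_iff.1 hx
  rw [rowFrom, rowFrom, hrow, Option.getD_some, List.drop_eq_getElem_cons]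

theorem exists_entry_of_mem_rowBefore {T : STab} {r k : ℕ} {x : Letter}
    (h : x ∈ rowBefore T r k) : ∃ c, r ≤ c ∧ c < r + k ∧ entry? T r c = some x := by
  obtain ⟨i, hi⟩ := List.mem_iff_getElem?.1 h
  rw [rowBefore, List.getElem?_take] at hi
  split_ifs at hi with hik
  cases hr : T[r]? with
  | none => simp [hr] at hi
  | some row =>
    rw [hr, Option.getD_some] at hi
    exact ⟨r + i, by omega, by omega, entry?_eq_some.2 ⟨by omega, row, hr, by simpa using hi⟩⟩

theorem exists_entry_of_mem_rowFrom {T : STab} {r k : ℕ} {x : Letter}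
    (h : x ∈ rowFrom T r k) : ∃ c, r + k ≤ c ∧ entry? T r c = some x := by
  obtain ⟨i, hi⟩ := List.mem_iff_getElem?.1 h
  rw [rowFrom, List.getElem?_drop] at hi
  cases hr : T[r]? with
  | none => simp [hr] at hi
  | some row =>
    rw [hr, Option.getD_some] at hi
    exact ⟨r + (k + i), by omega, entry?_eq_some.2 ⟨by omega, row, hr, by simpa using hi⟩⟩

theorem exists_rowWord_eq_of_adjacent {T : STab} {r c : ℕ} {x y : Letter}
    (hx : entry? T r c = some x)
    (hy : entry? T r (c + 1) = some y) : ∃ p q, rowWord T = p ++ x :: y :: q := by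
  obtain ⟨q, hq⟩ := exists_rowWord_eq T r
  have hrc := (entry?_eq_some.1 hx).1
  have e := rowFrom_eq_of_entry hy
  rw [Nat.succ_sub hrc] at e
  exact ⟨rowWordFrom T (r + 1) ++ rowBefore T r (c - r), rowFrom T r (c - r + 1 + 1) ++ q, by
    rw [hq, rowWordFrom_eq, row_eq_of_entry hx, e]; simp⟩

theorem row_ceil_lt_of_rowWord {T : STab} (hI : IsIncreasing T)
    (hw : IsReducedPrimed (rowWord T)) {r c : ℕ} {x y : Letter} (hx : entry? T r c = some x)
    (hy : entry? T r (c + 1) = some y) : x.ceil < y.ceil := by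
  obtain ⟨p, q, e⟩ := exists_rowWord_eq_of_adjacent hx hy
  exact Letter.ceil_lt_of_lt_of_ne (hI.1 _ _ _ _ hx hy) (hw.ceil_ne_of_adjacent e)

theorem col_ceil_lt_of_rowWord {T : STab} (hT : IsShifted T) (hI : IsIncreasing T)
    (hw : IsReducedPrimed (rowWord T)) {r c : ℕ} {y x : Letter} (hy : entry? T r c = some y)
    (hx : entry? T (r + 1) c = some x) : y.ceil < x.ceil := by
  refine Letter.ceil_lt_of_lt_of_ne (hI.2 _ _ _ _ hy hx) fun hxy => ?_
  have hyp := Letter.primed_of_lt_of_ceil_eq (hI.2 _ _ _ _ hy hx) hxy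
  have hrc := (entry?_eq_some.1 hx).1
  obtain ⟨c, rfl⟩ : ∃ d, c = d + 1 := ⟨c - 1, by omega⟩
  have hB : ∀ v ∈ rowFrom T (r + 1) (c + 1 - (r + 1) + 1), x.ceil + 2 ≤ v.ceil := by
    intro v hv
    obtain ⟨d, hd, hv⟩ := exists_entry_of_mem_rowFrom hv
    obtain ⟨b, hb, hbv⟩ := hT.exists_entry_le hI (r := r + 1) (c := c + 1 + 1)
      (by omega) le_rfl (by omega) hv
    obtain ⟨e, he⟩ := hT.exists_entry_below hb
    have h₁ := row_ceil_lt_of_rowWord hI hw hy he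
    have h₂ := row_ceil_lt_of_rowWord hI hw hx hb
    have h₃ := hI.2 _ _ _ _ he hb
    have h₄ := Letter.ceil_le_of_lt h₃
    have h₅ := Letter.ceil_le_of_le hbv
    by_contra hlt
    have hep := Letter.primed_of_lt_of_ceil_eq h₃ (by omega)
    obtain ⟨p, q, e'⟩ := exists_rowWord_eq_of_adjacent hy he
    exact hw.false_of_adjacent_primed e' hyp hep (by omega)
  obtain ⟨w, hw'⟩ := exists_entry_left (by omega) hy
  have hwy := row_ceil_lt_of_rowWord hI hw hw' hy
  obtain ⟨q, hq⟩ := exists_rowWord_eq T r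
  have hword : rowWord T = (rowWordFrom T (r + 1 + 1) ++ rowBefore T (r + 1) (c + 1 - (r + 1))) ++
      x :: ((rowFrom T (r + 1) (c + 1 - (r + 1) + 1) ++ rowBefore T r (c - r)) ++
        w :: y :: (rowFrom T r (c + 1 - r + 1) ++ q)) := by
    rw [hq, rowWordFrom_eq, rowWordFrom_eq, row_eq_of_entry hx, row_eq_of_entry hy,
      rowBefore_eq_of_entry hw']
    simp
  have hA : ∀ v ∈ rowBefore T r (c - r), v.ceil < w.ceil := by
    intro v hv
    obtain ⟨d, hrd, hd, hv⟩ := exists_entry_of_mem_rowBefore hv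
    obtain ⟨v', hv', hle⟩ := hT.exists_entry_le hI (r := r) (c := d + 1)
      (by omega) le_rfl (by omega) hw'
    have h₁ := row_ceil_lt_of_rowWord hI hw hv hv'
    have h₂ := Letter.ceil_le_of_le hle
    omega
  by_cases hwc : w.ceil = y.ceil - 1
  · rcases Nat.eq_or_lt_of_le hrc with hd | hd
    · have hc : c = r := by omega
      subst hc
      refine hw.false_of_large_start (by simpa [rowBefore] using hword) hxy.symm hwc hyp ?_ ?_
      · intro v hv
        obtain ⟨r', c', hr', hv⟩ := exists_entry_of_mem_rowWordFrom hv
        have := (entry?_eq_some.1 hv).1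
        obtain ⟨b, hb, hbv⟩ := hT.exists_entry_le hI (r := c + 1) (c := c + 1 + 1)
          (by omega) (by omega) (by omega) hv
        have h₁ := hB b (by
          rw [show c + 1 - (c + 1) + 1 = c + 1 + 1 - (c + 1) by omega, rowFrom_eq_of_entry hb]
          simp)
        have h₂ := Letter.ceil_le_of_le hbv
        omega
      · intro v hv
        have := hB v (by simpa using hv)
        omega
    · obtain ⟨f, hf⟩ := exists_entry_left (by omega) hx
      have h₁ := row_ceil_lt_of_rowWord hI hw hf hx
      have h₂ := hI.2 _ _ _ _ hw' hf
      have h₃ := Letter.ceil_le_of_lt h₂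
      have hwp := Letter.primed_of_lt_of_ceil_eq h₂ (by omega)
      obtain ⟨p, q, e⟩ := exists_rowWord_eq_of_adjacent hw' hy
      exact hw.false_of_adjacent_primed e hwp hyp (by omega)
  · refine hw.false_of_far (p := rowWordFrom T (r + 1 + 1) ++
      rowBefore T (r + 1) (c + 1 - (r + 1)))
      (m := rowFrom T (r + 1) (c + 1 - (r + 1) + 1) ++ rowBefore T r (c - r) ++ [w])
      (x := x) (y := y) (q := rowFrom T r (c + 1 - r + 1) ++ q)
      (by rw [hword]; simp) hxy.symm ?_
    intro v hv
    simp only [List.mem_append, List.mem_singleton] at hv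
    rcases hv with (hv | hv) | rfl
    · exact Or.inr (hB v hv)
    · have := hA v hv
      omega
    · omega

/-! ## The column reading word -/

/-- The letters of column `c` in rows before `n`, read from top to bottom. -/
def colPart (T : STab) (c n : ℕ) : PWord :=
  ((List.range n).reverse).filterMap (fun r => entry? T r c)

theorem colPart_succ {T : STab} {c n : ℕ} {x : Letter} (h : entry? T n c = some x) :
    colPart T c (n + 1) = x :: colPart T c n := by
  simp [colPart, List.range_succ, h]

theorem exists_colPart_eq (T : STab) (c n k : ℕ) :
    ∃ l, colPart T c (n + k) = l ++ colPart T c n ∧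
      ∀ x ∈ l, ∃ r, n ≤ r ∧ r < n + k ∧ entry? T r c = some x := by
  induction k with
  | zero => exact ⟨[], by simp⟩
  | succ k ih =>
    obtain ⟨l, hl, hm⟩ := ih
    refine ⟨(entry? T (n + k) c).toList ++ l, ?_, ?_⟩
    · rw [List.append_assoc, ← hl, ← Nat.add_assoc]
      cases h : entry? T (n + k) c with
      | none => simp [colPart, List.range_succ, h]
      | some x => simp [colPart_succ h]
    · intro x hx
      rcases List.mem_append.1 hx with hx | hx
      · exact ⟨n + k, by omega, by omega, by simpa using hx⟩
      · obtain ⟨r, h₁, h₂, h₃⟩ := hm x hx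
        exact ⟨r, h₁, by omega, h₃⟩

theorem exists_entry_of_mem_colPart {T : STab} {c n : ℕ} {x : Letter} (h : x ∈ colPart T c n) :
    ∃ r, r < n ∧ entry? T r c = some x := by
  obtain ⟨r, hr, hx⟩ := List.mem_filterMap.1 h
  exact ⟨r, by simpa using hr, hx⟩

/-- The part of the column reading word that comes from columns before `n`. -/
def colWordBefore (T : STab) (n : ℕ) : PWord :=
  (List.range n).flatMap fun c => colPart T c (c + 1)

theorem colWordBefore_succ (T : STab) (n : ℕ) :
    colWordBefore T (n + 1) = colWordBefore T n ++ colPart T n (n + 1) := by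
  simp [colWordBefore, List.range_succ]

theorem exists_entry_of_mem_colWordBefore {T : STab} {n : ℕ} {x : Letter}
    (h : x ∈ colWordBefore T n) : ∃ r c, c < n ∧ entry? T r c = some x := by
  obtain ⟨c, hc, hx⟩ := List.mem_flatMap.1 h
  obtain ⟨r, -, hr⟩ := exists_entry_of_mem_colPart hx
  exact ⟨r, c, by simpa using hc, hr⟩

theorem exists_colWord_eq_of_le {T : STab} {n : ℕ} (h : n ≤ numCols T) :
    ∃ q, colWord T = colWordBefore T n ++ q := by
  obtain ⟨k, hk⟩ := Nat.exists_eq_add_of_le h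
  have : colWord T = colWordBefore T (n + k) := by rw [← hk]; rfl
  rw [this, colWordBefore, List.range_add, List.flatMap_append]
  exact ⟨_, rfl⟩

theorem exists_colWord_eq {T : STab} (hT : IsShifted T) (hI : IsIncreasing T) {r c : ℕ}
    {x : Letter} (hx : entry? T r c = some x) :
    ∃ q, colWord T = colWordBefore T (c + 1) ++ q := by
  obtain ⟨w, hw, -⟩ := hT.exists_entry_le hI (Nat.zero_le _) (Nat.zero_le _) le_rfl hx
  obtain ⟨-, row, hrow, hx⟩ := entry?_eq_some.1 hw
  obtain ⟨hc, -⟩ := List.getElem?_eq_some_iff.1 hx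
  refine exists_colWord_eq_of_le ?_
  rw [numCols, List.getD_eq_getElem?_getD, hrow, Option.getD_some]
  omega

theorem exists_colWord_eq_of_adjacent {T : STab} (hT : IsShifted T) (hI : IsIncreasing T)
    {r c : ℕ} {x y : Letter} (hx : entry? T r c = some x)
    (hy : entry? T (r + 1) c = some y) : ∃ p q, colWord T = p ++ y :: x :: q := by
  obtain ⟨q, hq⟩ := exists_colWord_eq hT hI hx
  have hrc := (entry?_eq_some.1 hy).1
  obtain ⟨k, rfl⟩ := Nat.exists_eq_add_of_le hrc
  obtain ⟨l, hl, -⟩ := exists_colPart_eq T (r + 1 + k) (r + 1 + 1) k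
  rw [colPart_succ hy, colPart_succ hx] at hl
  refine ⟨colWordBefore T (r + 1 + k) ++ l, colPart T (r + 1 + k) r ++ q, ?_⟩
  rw [hq, colWordBefore_succ, show r + 1 + k + 1 = r + 1 + 1 + k by omega, hl]
  simp

theorem col_ceil_lt_of_colWord {T : STab} (hT : IsShifted T) (hI : IsIncreasing T)
    (hw : IsReducedPrimed (colWord T)) {r c : ℕ} {x y : Letter} (hx : entry? T r c = some x)
    (hy : entry? T (r + 1) c = some y) : x.ceil < y.ceil := by
  obtain ⟨p, q, e⟩ := exists_colWord_eq_of_adjacent hT hI hx hy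
  exact Letter.ceil_lt_of_lt_of_ne (hI.2 _ _ _ _ hx hy) (hw.ceil_ne_of_adjacent e).symm

theorem row_ceil_lt_of_colWord {T : STab} (hT : IsShifted T) (hI : IsIncreasing T)
    (hw : IsReducedPrimed (colWord T)) {r c : ℕ} {x y : Letter} (hx : entry? T r c = some x)
    (hy : entry? T r (c + 1) = some y) : x.ceil < y.ceil := by
  refine Letter.ceil_lt_of_lt_of_ne (hI.1 _ _ _ _ hx hy) fun hxy => ?_
  have hxp := Letter.primed_of_lt_of_ceil_eq (hI.1 _ _ _ _ hx hy) hxy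
  have hrc := (entry?_eq_some.1 hx).1
  have hsmall : ∀ s a, s + 1 = r → entry? T s c = some a → a.ceil ≤ x.ceil - 2 := by
    rintro s a rfl ha
    obtain ⟨e, he⟩ := hT.exists_entry_below hy
    have h₁ := col_ceil_lt_of_colWord hT hI hw ha hx
    have h₂ := col_ceil_lt_of_colWord hT hI hw he hy
    have h₃ := hI.1 _ _ _ _ ha he
    have h₄ := Letter.ceil_le_of_lt h₃
    by_contra hlt
    have hap := Letter.primed_of_lt_of_ceil_eq h₃ (by omega)
    obtain ⟨p, q, e'⟩ := exists_colWord_eq_of_adjacent hT hI ha hx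
    exact hw.false_of_adjacent_primed e' hxp hap (by omega)
  have hLo : ∀ v ∈ colPart T c r, v.ceil ≤ x.ceil - 2 := by
    intro v hv
    obtain ⟨r', hr', hv'⟩ := exists_entry_of_mem_colPart hv
    obtain ⟨s, rfl⟩ : ∃ s, r = s + 1 := ⟨r - 1, by omega⟩
    obtain ⟨a, ha⟩ := hT.exists_entry_below hx
    have h₁ := hsmall s a rfl ha
    have h₂ := Letter.ceil_le_of_le (hT.le_of_entry hI (by omega) le_rfl hv' ha)
    omega
  obtain ⟨k, rfl⟩ := Nat.exists_eq_add_of_le hrc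
  obtain ⟨q, hq⟩ := exists_colWord_eq hT hI hy
  obtain ⟨l, hl, -⟩ := exists_colPart_eq T (r + k) (r + 1) k
  obtain ⟨m, hm, hmem⟩ := exists_colPart_eq T (r + k + 1) (r + 1) (k + 1)
  rw [colPart_succ hx] at hl
  rw [colPart_succ hy] at hm
  have hword : colWord T = (colWordBefore T (r + k) ++ l) ++ x :: ((colPart T (r + k) r ++ m) ++
      y :: (colPart T (r + k + 1) r ++ q)) := by
    rw [hq, colWordBefore_succ, colWordBefore_succ, show r + k + 1 + 1 = r + 1 + (k + 1) by omega,
      hm, show r + k + 1 = r + 1 + k by omega, hl]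
    simp
  by_cases hm' : ∀ v ∈ m, x.ceil + 2 ≤ v.ceil
  · refine hw.false_of_far hword hxy fun v hv => ?_
    rcases List.mem_append.1 hv with hv | hv
    · exact Or.inl (hLo v hv)
    · exact Or.inr (hm' v hv)
  push Not at hm'
  obtain ⟨v, hvm, hlt⟩ := hm'
  obtain ⟨r', hr₁, hr₂, hv⟩ := hmem v hvm
  obtain ⟨b, hb, hbv⟩ := hT.exists_entry_le hI (by omega) hr₁ le_rfl hv
  have h₁ := col_ceil_lt_of_colWord hT hI hw hy hb
  have h₂ := Letter.ceil_le_of_le hbv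
  rcases Nat.eq_zero_or_pos k with rfl | hk
  · have hm₁ : m = [b] := by
      have := colPart_succ hb
      rw [colPart_succ hy] at this
      rw [show r + 1 + (0 + 1) = r + 1 + 1 by rfl, this] at hm
      exact (List.append_cancel_right (as := [b]) hm).symm
    have hl₁ : l = [] := by
      have := colPart_succ hx
      rw [show r + 1 + 0 = r + 1 by rfl, this] at hl
      exact (List.append_cancel_right (as := []) hl).symm
    subst hm₁ hl₁
    refine hw.false_of_small_start (p := colWordBefore T (r + 0)) (m := colPart T (r + 0) r)
      (w := b) (by simpa using hword) hxy (by omega) hxp ?_ hLo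
    intro u hu
    obtain ⟨r₀, c₀, hc₀, hu'⟩ := exists_entry_of_mem_colWordBefore hu
    have := (entry?_eq_some.1 hu').1
    obtain ⟨s, rfl⟩ : ∃ s, r = s + 1 := ⟨r - 1, by omega⟩
    obtain ⟨a, ha⟩ := hT.exists_entry_below hx
    have g₁ := hsmall s a rfl ha
    have g₂ := Letter.ceil_le_of_le (hT.le_of_entry hI (by omega) (by omega) hu' ha)
    omega
  · obtain ⟨f, hf⟩ := exists_entry_left (by omega) hb
    have g₁ := col_ceil_lt_of_colWord hT hI hw hx hf
    have g₂ := hI.1 _ _ _ _ hf hb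
    have g₃ := Letter.ceil_le_of_lt g₂
    have hfp := Letter.primed_of_lt_of_ceil_eq g₂ (by omega)
    obtain ⟨p, q, e⟩ := exists_colWord_eq_of_adjacent hT hI hx hf
    exact hw.false_of_adjacent_primed e hfp hxp (by omega)

theorem isIncreasing_unprimeT_iff (T : STab) : IsIncreasing (unprimeT T) ↔
    (∀ r c x y, entry? T r c = some x → entry? T r (c + 1) = some y → x.ceil < y.ceil) ∧
    (∀ r c x y, entry? T r c = some x → entry? T (r + 1) c = some y → x.ceil < y.ceil) := by
  have hlt (x y : Letter) : x.unprime < y.unprime ↔ x.ceil < y.ceil := by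
    simp [Letter.lt_iff, Letter.unprime]
  have hpair (a b : Option Letter) :
      (∀ x y, a.map Letter.unprime = some x → b.map Letter.unprime = some y → x < y) ↔
        ∀ x y, a = some x → b = some y → x.ceil < y.ceil := by
    cases a <;> cases b <;> simp [hlt]
  simp only [IsIncreasing, entry?_unprimeT, hpair]

/-- if `row(T)` or `col(T)` is a primed involution word for an element
of `I_ℤ`, then `T` is increasing iff `unprime(T)` is increasing. -/
theorem stmt2 (T : STab) (hT : IsShifted T)
    (h : ∃ z : Equiv.Perm ℤ, IZ z ∧ (rowWord T ∈ RinvPlus z ∨ colWord T ∈ RinvPlus z)) :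
    IsIncreasing T ↔ IsIncreasing (unprimeT T) := by
  obtain ⟨z, -, hw⟩ := h
  rw [isIncreasing_unprimeT_iff]
  constructor
  · intro hI
    rcases hw with hw | hw
    · have hw := isReducedPrimed_of_mem hw
      exact ⟨fun _ _ _ _ hx hy => row_ceil_lt_of_rowWord hI hw hx hy,
        fun _ _ _ _ hx hy => col_ceil_lt_of_rowWord hT hI hw hx hy⟩
    · have hw := isReducedPrimed_of_mem hw
      exact ⟨fun _ _ _ _ hx hy => row_ceil_lt_of_colWord hT hI hw hx hy,
        fun _ _ _ _ hx hy => col_ceil_lt_of_colWord hT hI hw hx hy⟩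
  · exact fun hI => ⟨fun r c x y hx hy => Letter.lt_iff.2 (Or.inl (hI.1 r c x y hx hy)),
      fun r c x y hx hy => Letter.lt_iff.2 (Or.inl (hI.2 r c x y hx hy))⟩
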